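/- Let V₁, V₂, V₃ be complex vector spaces with sl₂-actions, v_i ∈ V_i primitive of weights m_i (nonnegative integers) with f^{m_i+1} v_i = 0, let S_i be contravariant symmetric bilinear forms, and S = S₁⊗S₂⊗S₃. Let r be a nonnegative integer. Then for every admissible r₁: (i) W_{r₁} is a singular vector of weight m₁+m₂+m₃−2r for the diagonal sl₂-action on V₁⊗V₂⊗V₃, i.e. e·W_{r₁} = 0 and h·W_{r₁} = (m₁+m₂+m₃−2r)·W_{r₁}; and (ii) for admissible r₁ ≠ r₁', S(W_{r₁}, W_{r₁'}) = 0. -/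

import Mathlib

open scoped TensorProduct

/-- An sl₂-action on a complex vector space `V`. -/
def IsSl2Action {V : Type*} [AddCommGroup V] [Module ℂ V]
    (e f h : Module.End ℂ V) : Prop :=
  h ∘ₗ e - e ∘ₗ h = (2 : ℂ) • e ∧ h ∘ₗ f - f ∘ₗ h = (-2 : ℂ) • f ∧ e ∘ₗ f - f ∘ₗ e = h

/-- The falling factorial `(x)_n = x(x−1)⋯(x−n+1)`, with `(x)_0 = 1`. -/
noncomputable def fallFac (x : ℂ) (n : ℕ) : ℂ := ∏ i ∈ Finset.range n, (x - i)

/-- `r₁` is admissible for `(m₁, m₂, m₃, r)` when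
`max(0, r−m₃) ≤ r₁ ≤ min(r, min(m₁,m₂), m₁+m₂−r)`. -/
def Admissible (m₁ m₂ m₃ r : ℕ) (k : ℤ) : Prop :=
  (r : ℤ) - (m₃ : ℤ) ≤ k ∧ 0 ≤ k ∧ k ≤ (r : ℤ) ∧ k ≤ (m₁ : ℤ) ∧ k ≤ (m₂ : ℤ) ∧
    k ≤ (m₁ : ℤ) + (m₂ : ℤ) - (r : ℤ)

/-- The coefficient `C^{r₁}_{i,j}` from the Shapovalov basis formula. -/
noncomputable def Ccoef (m₁ m₂ m₃ r r₁ i j : ℕ) : ℂ :=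
  (1 / (fallFac (m₁ : ℂ) i * fallFac (m₂ : ℂ) (r₁ - i) *
      (Nat.factorial i : ℂ) * (Nat.factorial (r₁ - i) : ℂ))) *
  (1 / (fallFac ((m₁ : ℂ) + (m₂ : ℂ) - 2 * (r₁ : ℂ)) j * fallFac (m₃ : ℂ) (r - r₁ - j) *
      (Nat.factorial j : ℂ) * (Nat.factorial (r - r₁ - j) : ℂ)))

/-- The (unnormalized) Shapovalov basis vector
`W_{r₁} = Σᵢⱼ (−1)^{i+j} C^{r₁}_{i,j} · f^j(fⁱv₁ ⊗ f^{r₁−i}v₂) ⊗ f^{r−r₁−j}v₃`,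
where `f` acts diagonally on the first two tensor factors. -/
noncomputable def Wvec {V₁ V₂ V₃ : Type*} [AddCommGroup V₁] [Module ℂ V₁]
    [AddCommGroup V₂] [Module ℂ V₂] [AddCommGroup V₃] [Module ℂ V₃]
    (f₁ : Module.End ℂ V₁) (f₂ : Module.End ℂ V₂) (f₃ : Module.End ℂ V₃)
    (v₁ : V₁) (v₂ : V₂) (v₃ : V₃) (m₁ m₂ m₃ r r₁ : ℕ) : (V₁ ⊗[ℂ] V₂) ⊗[ℂ] V₃ :=
  ∑ i ∈ Finset.range (r₁ + 1), ∑ j ∈ Finset.range (r - r₁ + 1),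
    ((-1 : ℂ) ^ (i + j) * Ccoef m₁ m₂ m₃ r r₁ i j) •
      ((((LinearMap.rTensor V₂ f₁ + LinearMap.lTensor V₁ f₂ :
            Module.End ℂ (V₁ ⊗[ℂ] V₂)) ^ j)
          (((f₁ ^ i) v₁) ⊗ₜ[ℂ] ((f₂ ^ (r₁ - i)) v₂))) ⊗ₜ[ℂ] ((f₃ ^ (r - r₁ - j)) v₃))

section Sl2

variable {V W : Type*} [AddCommGroup V] [Module ℂ V] [AddCommGroup W] [Module ℂ W]

/-- `v` is primitive of weight `c` for `e` and `h`. -/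
def IsPrimitiveVector (e h : Module.End ℂ V) (c : ℂ) (v : V) : Prop :=
  e v = 0 ∧ h v = c • v

lemma IsSl2Action.h_f_apply {e f h : Module.End ℂ V} (H : IsSl2Action e f h) (x : V) :
    h (f x) = f (h x) - (2 : ℂ) • f x := by
  have := LinearMap.congr_fun H.2.1 x
  simp only [LinearMap.sub_apply, LinearMap.comp_apply, LinearMap.smul_apply] at this
  rw [sub_eq_iff_eq_add] at this
  rw [this]
  module

lemma IsSl2Action.e_f_apply {e f h : Module.End ℂ V} (H : IsSl2Action e f h) (x : V) :
    e (f x) = f (e x) + h x := by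
  have := LinearMap.congr_fun H.2.2 x
  simp only [LinearMap.sub_apply, LinearMap.comp_apply] at this
  rw [← this]
  abel

lemma IsPrimitiveVector.h_pow_f {e f h : Module.End ℂ V} (H : IsSl2Action e f h) {c : ℂ} {v : V}
    (hv : IsPrimitiveVector e h c v) (n : ℕ) :
    h ((f ^ n) v) = (c - 2 * n) • (f ^ n) v := by
  induction n with
  | zero => simp [hv.2]
  | succ n ih =>
    rw [pow_succ', Module.End.mul_apply, H.h_f_apply, ih, map_smul]
    push_cast
    module

lemma IsPrimitiveVector.e_pow_succ_f {e f h : Module.End ℂ V} (H : IsSl2Action e f h) {c : ℂ}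
    {v : V} (hv : IsPrimitiveVector e h c v) (n : ℕ) :
    e ((f ^ (n + 1)) v) = ((n + 1) * (c - n)) • (f ^ n) v := by
  induction n with
  | zero => simp [H.e_f_apply, hv.1, hv.2]
  | succ n ih =>
    rw [pow_succ', Module.End.mul_apply, H.e_f_apply, ih, hv.h_pow_f H, map_smul,
      ← Module.End.mul_apply, ← pow_succ']
    push_cast
    module

/-- Diagonal action of a pair of endomorphisms on a tensor product. -/
noncomputable abbrev diagAction (x : Module.End ℂ V) (y : Module.End ℂ W) :
    Module.End ℂ (V ⊗[ℂ] W) :=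
  LinearMap.rTensor W x + LinearMap.lTensor V y

lemma IsSl2Action.diagAction {e f h : Module.End ℂ V} {e' f' h' : Module.End ℂ W}
    (H : IsSl2Action e f h) (H' : IsSl2Action e' f' h') :
    IsSl2Action (diagAction e e') (diagAction f f') (diagAction h h') := by
  obtain ⟨a, b, c⟩ := H
  obtain ⟨a', b', c'⟩ := H'
  refine ⟨?_, ?_, ?_⟩ <;> refine TensorProduct.ext' fun x y => ?_
  · have p := congrArg (· ⊗ₜ[ℂ] y) (LinearMap.congr_fun a x)
    have q := congrArg (x ⊗ₜ[ℂ] ·) (LinearMap.congr_fun a' y)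
    simp [TensorProduct.tmul_sub, TensorProduct.sub_tmul, ← TensorProduct.smul_tmul'] at p q ⊢
    rw [← p, ← q]
    abel
  · have p := congrArg (· ⊗ₜ[ℂ] y) (LinearMap.congr_fun b x)
    have q := congrArg (x ⊗ₜ[ℂ] ·) (LinearMap.congr_fun b' y)
    simp [TensorProduct.tmul_sub, TensorProduct.sub_tmul, TensorProduct.tmul_neg,
      TensorProduct.neg_tmul, ← TensorProduct.smul_tmul'] at p q ⊢
    rw [← p, ← q]
    abel
  · have p := congrArg (· ⊗ₜ[ℂ] y) (LinearMap.congr_fun c x)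
    have q := congrArg (x ⊗ₜ[ℂ] ·) (LinearMap.congr_fun c' y)
    simp [TensorProduct.tmul_sub, TensorProduct.sub_tmul] at p q ⊢
    rw [← p, ← q]
    abel

/-- The vector of weight `a + b - 2 k` in `V ⊗ W` built from the descendants of `v` and `w`. -/
noncomputable def singularVec (f : Module.End ℂ V) (f' : Module.End ℂ W) (a b : ℂ) (v : V) (w : W)
    (k : ℕ) : V ⊗[ℂ] W :=
  ∑ i ∈ Finset.range (k + 1),
    ((-1 : ℂ) ^ i * (1 / (fallFac a i * fallFac b (k - i) * (Nat.factorial i : ℂ) *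
      (Nat.factorial (k - i) : ℂ)))) • (((f ^ i) v) ⊗ₜ[ℂ] ((f' ^ (k - i)) w))

lemma fallFac_succ (x : ℂ) (n : ℕ) : fallFac x (n + 1) = fallFac x n * (x - n) :=
  Finset.prod_range_succ _ _

lemma fallFac_natCast_ne_zero {m n : ℕ} (h : n ≤ m) : fallFac (m : ℂ) n ≠ 0 := by
  refine Finset.prod_ne_zero_iff.2 fun i hi => sub_ne_zero.2 ?_
  have := Finset.mem_range.1 hi
  exact_mod_cast (by omega : m ≠ i)

/-- The divided descendant `f ^ n v / ((a)_n n!)`. -/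
noncomputable def dividedDescendant (f : Module.End ℂ V) (a : ℂ) (v : V) (n : ℕ) : V :=
  (1 / (fallFac a n * (Nat.factorial n : ℂ))) • (f ^ n) v

lemma singularVec_eq_sum_dividedDescendant (f : Module.End ℂ V) (f' : Module.End ℂ W) (a b : ℂ)
    (v : V) (w : W) (k : ℕ) :
    singularVec f f' a b v w k = ∑ i ∈ Finset.range (k + 1),
      (-1 : ℂ) ^ i • (dividedDescendant f a v i ⊗ₜ[ℂ] dividedDescendant f' b w (k - i)) := by
  refine Finset.sum_congr rfl fun i _ => ?_
  simp only [dividedDescendant, TensorProduct.smul_tmul_smul, smul_smul]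
  congr 1
  simp only [one_div, mul_inv]
  ring

lemma e_dividedDescendant_zero {e h : Module.End ℂ V} (f : Module.End ℂ V) {a : ℂ} {v : V}
    (hv : IsPrimitiveVector e h a v) : e (dividedDescendant f a v 0) = 0 := by
  simp [dividedDescendant, hv.1]

lemma e_dividedDescendant_succ {e f h : Module.End ℂ V} (H : IsSl2Action e f h) {a : ℂ} {v : V}
    (hv : IsPrimitiveVector e h a v) {n : ℕ} (hn : fallFac a (n + 1) ≠ 0) :
    e (dividedDescendant f a v (n + 1)) = dividedDescendant f a v n := by
  rw [dividedDescendant, dividedDescendant, map_smul, hv.e_pow_succ_f H, smul_smul]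
  rw [fallFac_succ] at hn ⊢
  congr 1
  have h1 := left_ne_zero_of_mul hn
  have h2 := right_ne_zero_of_mul hn
  have h3 : ((n : ℂ) + 1) ≠ 0 := n.cast_add_one_ne_zero
  have h4 : (Nat.factorial n : ℂ) ≠ 0 := by exact_mod_cast n.factorial_ne_zero
  rw [Nat.factorial_succ]
  push_cast
  field_simp

lemma isPrimitiveVector_singularVec {e f h : Module.End ℂ V} {e' f' h' : Module.End ℂ W}
    (H : IsSl2Action e f h) (H' : IsSl2Action e' f' h') {a b : ℂ} {v : V} {w : W}
    (hv : IsPrimitiveVector e h a v) (hw : IsPrimitiveVector e' h' b w) {k : ℕ}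
    (ha : ∀ n ≤ k, fallFac a n ≠ 0) (hb : ∀ n ≤ k, fallFac b n ≠ 0) :
    IsPrimitiveVector (diagAction e e') (diagAction h h') (a + b - 2 * k)
      (singularVec f f' a b v w k) := by
  constructor
  · rw [singularVec_eq_sum_dividedDescendant]
    simp only [map_sum, map_smul, LinearMap.add_apply, LinearMap.rTensor_tmul,
      LinearMap.lTensor_tmul, smul_add, Finset.sum_add_distrib]
    rw [Finset.sum_range_succ', Finset.sum_range_succ _ k, Nat.sub_self,
      e_dividedDescendant_zero f hv, e_dividedDescendant_zero f' hw]
    simp only [TensorProduct.zero_tmul, TensorProduct.tmul_zero, smul_zero, add_zero]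
    rw [← Finset.sum_add_distrib]
    refine Finset.sum_eq_zero fun i hi => ?_
    have hi := Finset.mem_range.1 hi
    rw [e_dividedDescendant_succ H hv (ha _ (by omega)),
      show k - i = (k - (i + 1)) + 1 by omega,
      e_dividedDescendant_succ H' hw (hb _ (by omega)), pow_succ]
    module
  · rw [singularVec, map_sum, Finset.smul_sum]
    refine Finset.sum_congr rfl fun i hi => ?_
    have hi : i ≤ k := by have := Finset.mem_range.1 hi; omega
    rw [map_smul, smul_comm]
    congr 1
    rw [LinearMap.add_apply, LinearMap.rTensor_tmul, LinearMap.lTensor_tmul, hv.h_pow_f H,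
      hw.h_pow_f H', TensorProduct.tmul_smul, ← TensorProduct.smul_tmul', Nat.cast_sub hi]
    module

lemma form_pow_f_eq_zero_of_lt {e f h : Module.End ℂ V} (H : IsSl2Action e f h)
    (B : V → V → ℂ) (hB : ∀ x (c : ℂ) y, B x (c • y) = c * B x y)
    (hf : ∀ x y, B (f x) y = B x (e y)) {c : ℂ} {w : V} (v : V)
    (hw : IsPrimitiveVector e h c w) {i j : ℕ} (hij : j < i) :
    B ((f ^ i) v) ((f ^ j) w) = 0 := by
  induction j generalizing i with
  | zero =>
    obtain ⟨i, rfl⟩ := Nat.exists_eq_succ_of_ne_zero hij.ne'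
    rw [Nat.succ_eq_add_one, pow_succ', Module.End.mul_apply, hf, pow_zero, Module.End.one_apply,
      hw.1, ← zero_smul ℂ (0 : V), hB, zero_mul]
  | succ j ih =>
    obtain ⟨i, rfl⟩ := Nat.exists_eq_succ_of_ne_zero (by omega : i ≠ 0)
    rw [Nat.succ_eq_add_one, pow_succ' f i, Module.End.mul_apply, hf, hw.e_pow_succ_f H, hB,
      ih (by omega), mul_zero]

lemma form_pow_f_eq_zero_of_ne {e f h : Module.End ℂ V} (H : IsSl2Action e f h)
    (B : V →ₗ[ℂ] V →ₗ[ℂ] ℂ) (he : ∀ x y, B (e x) y = B x (f y))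
    (hf : ∀ x y, B (f x) y = B x (e y)) {c d : ℂ} {v w : V} (hv : IsPrimitiveVector e h c v)
    (hw : IsPrimitiveVector e h d w) {i j : ℕ} (hij : i ≠ j) :
    B ((f ^ i) v) ((f ^ j) w) = 0 := by
  rcases hij.lt_or_gt with hij | hij
  · exact form_pow_f_eq_zero_of_lt H (fun x y => B y x) (fun x c y => by simp)
      (fun x y => (he y x).symm) w hv hij
  · exact form_pow_f_eq_zero_of_lt H (fun x y => B x y) (fun x c y => by simp) hf v hw hij

end Sl2

section Triple

variable {V₁ V₂ V₃ : Type*} [AddCommGroup V₁] [Module ℂ V₁]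
    [AddCommGroup V₂] [Module ℂ V₂] [AddCommGroup V₃] [Module ℂ V₃]

lemma Wvec_eq_singularVec (f₁ : Module.End ℂ V₁) (f₂ : Module.End ℂ V₂) (f₃ : Module.End ℂ V₃)
    (v₁ : V₁) (v₂ : V₂) (v₃ : V₃) (m₁ m₂ m₃ r r₁ : ℕ) :
    Wvec f₁ f₂ f₃ v₁ v₂ v₃ m₁ m₂ m₃ r r₁ =
      singularVec (diagAction f₁ f₂) f₃ ((m₁ : ℂ) + m₂ - 2 * r₁) m₃
        (singularVec f₁ f₂ m₁ m₂ v₁ v₂ r₁) v₃ (r - r₁) := by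
  rw [Wvec, Finset.sum_comm, singularVec]
  refine Finset.sum_congr rfl fun j _ => ?_
  rw [singularVec, map_sum, TensorProduct.sum_tmul, Finset.smul_sum]
  refine Finset.sum_congr rfl fun i _ => ?_
  rw [map_smul, ← TensorProduct.smul_tmul', smul_smul, Ccoef, pow_add]
  congr 1
  ring

lemma tensorForm_adjoint_left {x₁ y₁ : Module.End ℂ V₁} {x₂ y₂ : Module.End ℂ V₂}
    {S₁ : V₁ →ₗ[ℂ] V₁ →ₗ[ℂ] ℂ} {S₂ : V₂ →ₗ[ℂ] V₂ →ₗ[ℂ] ℂ} {S₃ : V₃ →ₗ[ℂ] V₃ →ₗ[ℂ] ℂ}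
    {S : ((V₁ ⊗[ℂ] V₂) ⊗[ℂ] V₃) →ₗ[ℂ] ((V₁ ⊗[ℂ] V₂) ⊗[ℂ] V₃) →ₗ[ℂ] ℂ}
    (hS : ∀ (a a' : V₁) (b b' : V₂) (c c' : V₃),
      S ((a ⊗ₜ[ℂ] b) ⊗ₜ[ℂ] c) ((a' ⊗ₜ[ℂ] b') ⊗ₜ[ℂ] c') = S₁ a a' * S₂ b b' * S₃ c c')
    (h₁ : ∀ a a', S₁ (x₁ a) a' = S₁ a (y₁ a')) (h₂ : ∀ b b', S₂ (x₂ b) b' = S₂ b (y₂ b'))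
    (p q : V₁ ⊗[ℂ] V₂) (c c' : V₃) :
    S ((diagAction x₁ x₂ p) ⊗ₜ[ℂ] c) (q ⊗ₜ[ℂ] c') =
      S (p ⊗ₜ[ℂ] c) ((diagAction y₁ y₂ q) ⊗ₜ[ℂ] c') := by
  induction p with
  | zero => simp
  | add p p' hp hp' =>
    simp only [map_add, TensorProduct.add_tmul, LinearMap.add_apply] at *
    linear_combination hp + hp'
  | tmul a b =>
    induction q with
    | zero => simp
    | add q q' hq hq' =>
      simp only [map_add, TensorProduct.add_tmul, LinearMap.add_apply] at *
      linear_combination hq + hq'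
    | tmul a' b' =>
      simp [TensorProduct.add_tmul, hS, h₁, h₂]

lemma tensorForm_adjoint_right {x y : Module.End ℂ V₃}
    {S₁ : V₁ →ₗ[ℂ] V₁ →ₗ[ℂ] ℂ} {S₂ : V₂ →ₗ[ℂ] V₂ →ₗ[ℂ] ℂ} {S₃ : V₃ →ₗ[ℂ] V₃ →ₗ[ℂ] ℂ}
    {S : ((V₁ ⊗[ℂ] V₂) ⊗[ℂ] V₃) →ₗ[ℂ] ((V₁ ⊗[ℂ] V₂) ⊗[ℂ] V₃) →ₗ[ℂ] ℂ}
    (hS : ∀ (a a' : V₁) (b b' : V₂) (c c' : V₃),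
      S ((a ⊗ₜ[ℂ] b) ⊗ₜ[ℂ] c) ((a' ⊗ₜ[ℂ] b') ⊗ₜ[ℂ] c') = S₁ a a' * S₂ b b' * S₃ c c')
    (h₃ : ∀ c c', S₃ (x c) c' = S₃ c (y c')) (p q : V₁ ⊗[ℂ] V₂) (c c' : V₃) :
    S (p ⊗ₜ[ℂ] x c) (q ⊗ₜ[ℂ] c') = S (p ⊗ₜ[ℂ] c) (q ⊗ₜ[ℂ] y c') := by
  induction p with
  | zero => simp
  | add p p' hp hp' => simp only [map_add, TensorProduct.add_tmul, LinearMap.add_apply, hp, hp']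
  | tmul a b =>
    induction q with
    | zero => simp
    | add q q' hq hq' => simp only [map_add, TensorProduct.add_tmul, hq, hq']
    | tmul a' b' => simp [hS, h₃]

end Triple

/-- `W_{r₁}` is a singular vector of weight `m₁+m₂+m₃−2r` for the diagonal sl₂-action on
`V₁ ⊗ V₂ ⊗ V₃`, and the `W_{r₁}` for distinct admissible `r₁` are Shapovalov-orthogonal. -/
theorem Wvec_singular_and_orthogonal
    {V₁ V₂ V₃ : Type*} [AddCommGroup V₁] [Module ℂ V₁]
    [AddCommGroup V₂] [Module ℂ V₂] [AddCommGroup V₃] [Module ℂ V₃]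
    (e₁ f₁ h₁ : Module.End ℂ V₁) (e₂ f₂ h₂ : Module.End ℂ V₂) (e₃ f₃ h₃ : Module.End ℂ V₃)
    (hsl1 : IsSl2Action e₁ f₁ h₁) (hsl2 : IsSl2Action e₂ f₂ h₂) (hsl3 : IsSl2Action e₃ f₃ h₃)
    (m₁ m₂ m₃ : ℕ) (v₁ : V₁) (v₂ : V₂) (v₃ : V₃)
    (hv₁e : e₁ v₁ = 0) (hv₁h : h₁ v₁ = (m₁ : ℂ) • v₁) (hv₁nil : (f₁ ^ (m₁ + 1)) v₁ = 0)
    (hv₂e : e₂ v₂ = 0) (hv₂h : h₂ v₂ = (m₂ : ℂ) • v₂) (hv₂nil : (f₂ ^ (m₂ + 1)) v₂ = 0)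
    (hv₃e : e₃ v₃ = 0) (hv₃h : h₃ v₃ = (m₃ : ℂ) • v₃) (hv₃nil : (f₃ ^ (m₃ + 1)) v₃ = 0)
    (S₁ : V₁ →ₗ[ℂ] V₁ →ₗ[ℂ] ℂ) (S₂ : V₂ →ₗ[ℂ] V₂ →ₗ[ℂ] ℂ) (S₃ : V₃ →ₗ[ℂ] V₃ →ₗ[ℂ] ℂ)
    (hsymm₁ : ∀ x y : V₁, S₁ x y = S₁ y x) (hsymm₂ : ∀ x y : V₂, S₂ x y = S₂ y x)
    (hsymm₃ : ∀ x y : V₃, S₃ x y = S₃ y x)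
    (hcontra₁ : ∀ x y : V₁, S₁ (e₁ x) y = S₁ x (f₁ y))
    (hcontra₂ : ∀ x y : V₂, S₂ (e₂ x) y = S₂ x (f₂ y))
    (hcontra₃ : ∀ x y : V₃, S₃ (e₃ x) y = S₃ x (f₃ y))
    (S : ((V₁ ⊗[ℂ] V₂) ⊗[ℂ] V₃) →ₗ[ℂ] ((V₁ ⊗[ℂ] V₂) ⊗[ℂ] V₃) →ₗ[ℂ] ℂ)
    (hS : ∀ (a a' : V₁) (b b' : V₂) (c c' : V₃),
      S ((a ⊗ₜ[ℂ] b) ⊗ₜ[ℂ] c) ((a' ⊗ₜ[ℂ] b') ⊗ₜ[ℂ] c') = S₁ a a' * S₂ b b' * S₃ c c')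
    (r : ℕ) :
    ∀ r₁ : ℕ, Admissible m₁ m₂ m₃ r (r₁ : ℤ) →
      ((LinearMap.rTensor V₃ (LinearMap.rTensor V₂ e₁ + LinearMap.lTensor V₁ e₂) +
          LinearMap.lTensor (V₁ ⊗[ℂ] V₂) e₃) (Wvec f₁ f₂ f₃ v₁ v₂ v₃ m₁ m₂ m₃ r r₁) = 0 ∧
        (LinearMap.rTensor V₃ (LinearMap.rTensor V₂ h₁ + LinearMap.lTensor V₁ h₂) +
            LinearMap.lTensor (V₁ ⊗[ℂ] V₂) h₃) (Wvec f₁ f₂ f₃ v₁ v₂ v₃ m₁ m₂ m₃ r r₁) =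
          ((m₁ : ℂ) + (m₂ : ℂ) + (m₃ : ℂ) - 2 * (r : ℂ)) •
            Wvec f₁ f₂ f₃ v₁ v₂ v₃ m₁ m₂ m₃ r r₁) ∧
      (∀ r₁' : ℕ, Admissible m₁ m₂ m₃ r (r₁' : ℤ) → r₁ ≠ r₁' →
        S (Wvec f₁ f₂ f₃ v₁ v₂ v₃ m₁ m₂ m₃ r r₁) (Wvec f₁ f₂ f₃ v₁ v₂ v₃ m₁ m₂ m₃ r r₁') = 0) := by
  have hv₁ : IsPrimitiveVector e₁ h₁ (m₁ : ℂ) v₁ := ⟨hv₁e, hv₁h⟩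
  have hv₂ : IsPrimitiveVector e₂ h₂ (m₂ : ℂ) v₂ := ⟨hv₂e, hv₂h⟩
  have hv₃ : IsPrimitiveVector e₃ h₃ (m₃ : ℂ) v₃ := ⟨hv₃e, hv₃h⟩
  have hsl12 := hsl1.diagAction hsl2
  have hP : ∀ s : ℕ, Admissible m₁ m₂ m₃ r (s : ℤ) →
      IsPrimitiveVector (diagAction e₁ e₂) (diagAction h₁ h₂) ((m₁ : ℂ) + m₂ - 2 * s)
        (singularVec f₁ f₂ m₁ m₂ v₁ v₂ s) := by
    rintro s ⟨-, -, -, hs₁, hs₂, -⟩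
    exact isPrimitiveVector_singularVec hsl1 hsl2 hv₁ hv₂
      (fun n hn => fallFac_natCast_ne_zero (by omega))
      (fun n hn => fallFac_natCast_ne_zero (by omega))
  have hfadj₁ : ∀ x y, S₁ (f₁ x) y = S₁ x (e₁ y) := fun x y => by
    rw [hsymm₁, ← hcontra₁, hsymm₁]
  have hfadj₂ : ∀ x y, S₂ (f₂ x) y = S₂ x (e₂ y) := fun x y => by
    rw [hsymm₂, ← hcontra₂, hsymm₂]
  have hfadj₃ : ∀ x y, S₃ (f₃ x) y = S₃ x (e₃ y) := fun x y => by
    rw [hsymm₃, ← hcontra₃, hsymm₃]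
  intro r₁ hr₁
  refine ⟨?_, fun r₁' hr₁' hne => ?_⟩
  · obtain ⟨k₁, -, k₂, k₃, k₄, k₅⟩ := id hr₁
    have hW := isPrimitiveVector_singularVec (k := r - r₁) hsl12 hsl3 (hP r₁ hr₁) hv₃
      (fun n hn => by
        have hcast : (m₁ : ℂ) + m₂ - 2 * r₁ = ((m₁ + m₂ - 2 * r₁ : ℕ) : ℂ) := by
          rw [Nat.cast_sub (by omega)]
          push_cast
          ring
        rw [hcast]
        exact fallFac_natCast_ne_zero (by omega))
      (fun n hn => fallFac_natCast_ne_zero (by omega))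
    rw [← Wvec_eq_singularVec] at hW
    refine ⟨hW.1, hW.2.trans ?_⟩
    rw [Nat.cast_sub (by omega)]
    congr 1
    ring
  · have hp := hP r₁ hr₁
    have hp' := hP r₁' hr₁'
    rw [Wvec_eq_singularVec, Wvec_eq_singularVec]
    generalize singularVec f₁ f₂ m₁ m₂ v₁ v₂ r₁ = p at hp ⊢
    generalize singularVec f₁ f₂ m₁ m₂ v₁ v₂ r₁' = p' at hp' ⊢
    rw [singularVec, singularVec]
    simp only [map_sum, LinearMap.sum_apply, map_smul, LinearMap.smul_apply]
    refine Finset.sum_eq_zero fun j hj => ?_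
    rw [Finset.sum_eq_zero, smul_zero]
    intro j' hj'
    have hj := Finset.mem_range.1 hj
    have hj' := Finset.mem_range.1 hj'
    convert smul_zero _
    by_cases hjj : j' = j
    · have hk : r - r₁' - j' ≠ r - r₁ - j := by
        have := hr₁.2.2.1
        have := hr₁'.2.2.1
        omega
      exact form_pow_f_eq_zero_of_ne hsl3
        (S.compl₁₂ (TensorProduct.mk ℂ (V₁ ⊗[ℂ] V₂) V₃ _) (TensorProduct.mk ℂ (V₁ ⊗[ℂ] V₂) V₃ _))
        (fun x y => tensorForm_adjoint_right hS hcontra₃ _ _ x y)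
        (fun x y => tensorForm_adjoint_right hS hfadj₃ _ _ x y) hv₃ hv₃ (by omega)
    · exact form_pow_f_eq_zero_of_ne hsl12
        (S.compl₁₂ ((TensorProduct.mk ℂ (V₁ ⊗[ℂ] V₂) V₃).flip _)
          ((TensorProduct.mk ℂ (V₁ ⊗[ℂ] V₂) V₃).flip _))
        (fun x y => tensorForm_adjoint_left hS hcontra₁ hcontra₂ x y _ _)
        (fun x y => tensorForm_adjoint_left hS hfadj₁ hfadj₂ x y _ _)
        hp hp' (by omega)
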